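/- Suppose the batch weights satisfy min_{n∈{2,…,K}} w_n · (n−1)/n > 1/(2K). Then for every θ ∈ ℝ^K with a unique best arm, min_{n∈{2,…,K}} w_n · Γ_{θ,n} > Δ_min(θ)² / (4·K·σ²); that is, the large-deviation rate of batched arm elimination strictly exceeds the efficiency exponent Δ_min(θ)²/(4Kσ²) of the completely randomized trial on every problem instance. -/

import Mathlib

/-- `Γ_{θ,n}`: the minimum, over subsets `J` of cardinality `n` containing the best arm `Istar`,
of the infimum over `λ` with `λ_{Istar} ≤ λ_i` for all `i ∈ J` of `Σ_{i∈J} (λ_i − θ_i)²/(2σ²)`. -/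
noncomputable def Gamma (K : ℕ) (σ : ℝ) (θ : Fin K → ℝ) (Istar : Fin K) (n : ℕ) : ℝ :=
  sInf { v : ℝ | ∃ J : Finset (Fin K), J.card = n ∧ Istar ∈ J ∧
    v = sInf { u : ℝ | ∃ lam : Fin K → ℝ, (∀ i ∈ J, lam Istar ≤ lam i) ∧
      u = ∑ i ∈ J, (lam i - θ i) ^ 2 / (2 * σ ^ 2) } }

/-- `w_n = Σ_{m=n}^K β_m / m`. -/
noncomputable def w (K : ℕ) (β : ℕ → ℝ) (n : ℕ) : ℝ :=
  ∑ m ∈ Finset.Icc n K, β m / m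

/-- Lower bound of the inner objective. -/
lemma inner_bound (K : ℕ) (σ : ℝ) (hσ : 0 < σ) (θ : Fin K → ℝ) (I : Fin K) (D : ℝ) (hD : 0 ≤ D)
    (hgap : ∀ j, j ≠ I → D ≤ θ I - θ j) (n : ℕ) (hn : 2 ≤ n) (J : Finset (Fin K))
    (hJ : J.card = n) (hI : I ∈ J) (lam : Fin K → ℝ) (hl : ∀ i ∈ J, lam I ≤ lam i) :
    (((n : ℝ) - 1) / n) * (D ^ 2 / (2 * σ ^ 2)) ≤ ∑ i ∈ J, (lam i - θ i) ^ 2 / (2 * σ ^ 2) := by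
  have hn0 : (0 : ℝ) < n := by
    have : 0 < n := by omega
    exact_mod_cast this
  obtain ⟨c, hc⟩ : ∃ c : ℝ, c = D / n := ⟨_, rfl⟩
  have hDc : D = n * c := by rw [hc]; field_simp
  have hc0 : 0 ≤ c := by rw [hc]; positivity
  have hcard : ((J.erase I).card : ℝ) = n - 1 := by
    rw [Finset.card_erase_of_mem hI, hJ, Nat.cast_sub (by omega)]; simp
  have h1 : ((n : ℝ) - 1) * (2 * c * (D - (θ I - lam I)) - c ^ 2)
      ≤ ∑ i ∈ J.erase I, (lam i - θ i) ^ 2 := by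
    rw [← hcard, ← nsmul_eq_mul]
    apply Finset.card_nsmul_le_sum
    intro i hi
    have hg := hgap i (Finset.ne_of_mem_erase hi)
    have hli := hl i (Finset.mem_of_mem_erase hi)
    have : c * (D - (θ I - lam I)) ≤ c * (lam i - θ i) :=
      mul_le_mul_of_nonneg_left (by linarith) hc0
    nlinarith [sq_nonneg (lam i - θ i - c)]
  have h2 : (((n : ℝ) - 1) / n) * D ^ 2 ≤ ∑ i ∈ J, (lam i - θ i) ^ 2 := by
    rw [← Finset.add_sum_erase _ _ hI]
    have : (((n : ℝ) - 1) / n) * D ^ 2 = (n - 1) * n * c ^ 2 := by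
      rw [hDc]; field_simp
    rw [this]
    rw [hDc] at h1
    nlinarith [sq_nonneg (θ I - lam I - (n - 1) * c)]
  rw [← Finset.sum_div, ← mul_div_assoc]
  exact div_le_div_of_nonneg_right h2 (by positivity)

lemma Gamma_bound (K : ℕ) (σ : ℝ) (hσ : 0 < σ) (θ : Fin K → ℝ) (I : Fin K) (D : ℝ) (hD : 0 ≤ D)
    (hgap : ∀ j, j ≠ I → D ≤ θ I - θ j) (n : ℕ) (hn : 2 ≤ n) (hnK : n ≤ K) :
    (((n : ℝ) - 1) / n) * (D ^ 2 / (2 * σ ^ 2)) ≤ Gamma K σ θ I n := by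
  unfold Gamma
  apply le_csInf
  · obtain ⟨J, h1, -, h2⟩ := Finset.exists_subsuperset_card_eq
      (Finset.subset_univ ({I} : Finset (Fin K))) (n := n) (by simp; omega) (by simpa using hnK)
    exact ⟨_, J, h2, h1 (by simp), rfl⟩
  · rintro v ⟨J, hJ, hI, rfl⟩
    apply le_csInf
    · exact ⟨_, fun _ => 0, by simp, rfl⟩
    · rintro u ⟨lam, hl, rfl⟩
      exact inner_bound K σ hσ θ I D hD hgap n hn J hJ hI lam hl

/-- If `min_{n∈{2,…,K}} w_n·(n−1)/n > 1/(2K)`, then on every instance with a unique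
best arm, `min_{n∈{2,…,K}} w_n·Γ_{θ,n} > Δ_min(θ)²/(4Kσ²)`, i.e., batched arm elimination
strictly dominates the completely randomized trial's efficiency exponent. -/
theorem stmt_7 (K : ℕ) (hK : 2 ≤ K) (σ : ℝ) (hσ : 0 < σ)
    (β : ℕ → ℝ) (hβ : ∀ m ∈ Finset.Icc 2 K, 0 ≤ β m)
    (hsum : ∑ m ∈ Finset.Icc 2 K, β m = 1)
    (hcond : (Finset.Icc 2 K).inf' (Finset.nonempty_Icc.mpr hK)
        (fun n => w K β n * (((n : ℝ) - 1) / n)) > 1 / (2 * K)) :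
    ∀ (θ : Fin K → ℝ) (Istar : Fin K), (∀ j, j ≠ Istar → θ j < θ Istar) →
      (Finset.Icc 2 K).inf' (Finset.nonempty_Icc.mpr hK)
          (fun n => w K β n * Gamma K σ θ Istar n)
        > (θ Istar - ⨆ j : {j : Fin K // j ≠ Istar}, θ j.1) ^ 2 / (4 * K * σ ^ 2) := by
  intro θ I hI
  have : Nontrivial (Fin K) := Fin.nontrivial_iff_two_le.mpr hK
  obtain ⟨j0, hj0⟩ := exists_ne I
  have : Nonempty {j : Fin K // j ≠ I} := ⟨⟨j0, hj0⟩⟩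
  set S := ⨆ j : {j : Fin K // j ≠ I}, θ j.1 with hS
  obtain ⟨j1, hj1⟩ := exists_eq_ciSup_of_finite (f := fun j : {j : Fin K // j ≠ I} => θ j.1)
  have hD : 0 < θ I - S := by
    have := hI j1.1 j1.2
    rw [hS, ← hj1]; linarith
  have hgap : ∀ j, j ≠ I → θ I - S ≤ θ I - θ j := by
    intro j hj
    have := le_ciSup (f := fun j : {j : Fin K // j ≠ I} => θ j.1)
      (Set.finite_range _).bddAbove ⟨j, hj⟩
    simp only at this
    linarith
  have hK0 : (0 : ℝ) < K := by
    have : 0 < K := by omega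
    exact_mod_cast this
  rw [gt_iff_lt, Finset.lt_inf'_iff] at hcond ⊢
  intro n hn
  have hc := hcond n hn
  obtain ⟨hn2, hnK⟩ := Finset.mem_Icc.mp hn
  have hG := Gamma_bound K σ hσ θ I (θ I - S) hD.le hgap n hn2 hnK
  have hw : 0 ≤ w K β n := by
    apply Finset.sum_nonneg
    intro m hm
    obtain ⟨a, b⟩ := Finset.mem_Icc.mp hm
    exact div_nonneg (hβ m (Finset.mem_Icc.mpr ⟨by omega, b⟩)) (by positivity)
  calc (θ I - S) ^ 2 / (4 * K * σ ^ 2)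
      = 1 / (2 * K) * ((θ I - S) ^ 2 / (2 * σ ^ 2)) := by field_simp; norm_num
    _ < w K β n * (((n : ℝ) - 1) / n) * ((θ I - S) ^ 2 / (2 * σ ^ 2)) :=
        mul_lt_mul_of_pos_right hc (by positivity)
    _ = w K β n * ((((n : ℝ) - 1) / n) * ((θ I - S) ^ 2 / (2 * σ ^ 2))) := by ring
    _ ≤ w K β n * Gamma K σ θ I n := mul_le_mul_of_nonneg_left hG hw
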